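/- (Random scalar case, distribution equivalence) Suppose X has support N_n = {1,…,n} with binary partition random variables (A_⟨α⟩, ⟨α⟩ ∈ Ω), X* is a random variable whose support 𝒳* has size at most n, and (B_⟨α⟩, ⟨α⟩ ∈ Ω) are random variables jointly distributed with X* such that H(B_⟨α⟩, ⟨α⟩ ∈ Δ) = H(A_⟨α⟩, ⟨α⟩ ∈ Δ) for every Δ ⊆ Ω and H(B_⟨α⟩ | X*) = 0 for every ⟨α⟩ ∈ Ω. Then there is a mapping σ : N_n → 𝒳* such that Pr(X = i) = Pr(X* = σ(i)) for all i ∈ N_n; in other words, the probability distributions of X and X* are the same up to renaming of outcomes. -/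

import Mathlib

open scoped BigOperators

/-- Probability of an event under a pmf `μ` on a finite outcome space. -/
noncomputable def probOf {Ω : Type*} [Fintype Ω] (μ : Ω → ℝ) (E : Set Ω) : ℝ :=
  ∑ ω, E.indicator μ ω

/-- Shannon entropy (in bits) of the random variable `X` on the finite
probability space `(Ω, μ)`. -/
noncomputable def shEntropy {Ω : Type*} {S : Type*} [Fintype Ω] (μ : Ω → ℝ) (X : Ω → S) : ℝ :=
  ∑ ω, μ ω * (- Real.logb 2 (probOf μ {ω' | X ω' = X ω}))

/-- Conditional Shannon entropy `H(Y | X)` (in bits). -/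
noncomputable def shCondEntropy {Ω S T : Type*} [Fintype Ω] (μ : Ω → ℝ)
    (Y : Ω → T) (X : Ω → S) : ℝ :=
  shEntropy μ (fun ω => (X ω, Y ω)) - shEntropy μ X

/-- The support of the random variable `X` (values taken with positive probability). -/
noncomputable def rvSupport {Ω S : Type*} [Fintype Ω] (μ : Ω → ℝ) (X : Ω → S) : Finset S := by
  classical exact (Finset.univ.filter fun ω => 0 < μ ω).image X

/-- `μ` is a probability mass function. -/
def IsPMF {Ω : Type*} [Fintype Ω] (μ : Ω → ℝ) : Prop :=
  (∀ ω, 0 ≤ μ ω) ∧ ∑ ω, μ ω = 1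

/-- A polymatroid on the finite ground set `Z`. -/
def IsPolymatroid {Z : Type*} [DecidableEq Z] (h : Finset Z → ℝ) : Prop :=
  h ∅ = 0 ∧ (∀ A : Finset Z, 0 ≤ h A) ∧ (∀ A B : Finset Z, A ⊆ B → h A ≤ h B) ∧
    ∀ A B : Finset Z, h (A ∩ B) + h (A ∪ B) ≤ h A + h B

/-- The binary partition random variable `A_⟨α⟩` of a random variable on
`Fin n` (the probability space is taken to be `Fin n` itself, with `X` the
identity): `A_⟨α⟩` records whether `X ∈ α` or `X ∈ αᶜ`.  Unordered partitions
`⟨α⟩ = {α, αᶜ}` are represented by the part `α` not containing the first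
element `0` (the paper's convention `1 ∉ α`). -/
def bpVar {n : ℕ} (α : Finset (Fin n)) : Fin n → Bool := fun x => decide (x ∈ α)

/-- The index set `Ω` of unordered binary partitions `⟨α⟩ = {α, αᶜ}` of
`{1, …, n}`, represented by the part `α` not containing the first element. -/
abbrev PartIdx (n : ℕ) [NeZero n] : Type :=
  {α : Finset (Fin n) // α.Nonempty ∧ 0 ∉ α}

section Entropy

variable {Ω S T : Type*} [Fintype Ω] {μ : Ω → ℝ}

theorem probOf_mono_of_pos (hμ : ∀ ω, 0 ≤ μ ω) {E F : Set Ω}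
    (h : ∀ ω, 0 < μ ω → ω ∈ E → ω ∈ F) : probOf μ E ≤ probOf μ F := by
  classical
  refine Finset.sum_le_sum fun ω _ => ?_
  by_cases hE : ω ∈ E <;> by_cases hF : ω ∈ F <;> simp [hE, hF, hμ ω]
  by_contra! hpos
  exact hF (h ω hpos hE)

theorem probOf_congr_of_pos (hμ : ∀ ω, 0 ≤ μ ω) {E F : Set Ω}
    (h : ∀ ω, 0 < μ ω → (ω ∈ E ↔ ω ∈ F)) : probOf μ E = probOf μ F :=
  le_antisymm (probOf_mono_of_pos hμ fun ω hω => (h ω hω).1)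
    (probOf_mono_of_pos hμ fun ω hω => (h ω hω).2)

theorem probOf_pos (hμ : ∀ ω, 0 ≤ μ ω) {E : Set Ω} {ω : Ω} (hω : 0 < μ ω) (hE : ω ∈ E) :
    0 < probOf μ E := by
  refine Finset.sum_pos' (fun ω' _ => Set.indicator_nonneg (fun x _ => hμ x) ω')
    ⟨ω, Finset.mem_univ ω, ?_⟩
  simpa [hE] using hω

theorem probOf_lt (hμ : ∀ ω, 0 ≤ μ ω) {E F : Set Ω} (h : E ⊆ F) {ω : Ω} (hω : 0 < μ ω)
    (hE : ω ∉ E) (hF : ω ∈ F) : probOf μ E < probOf μ F := by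
  refine Finset.sum_lt_sum (fun ω' _ => ?_) ⟨ω, Finset.mem_univ ω, ?_⟩
  · exact Set.indicator_le_indicator_of_subset h hμ ω'
  · simpa [hE, hF] using hω

theorem probOf_compl (hsum : ∑ ω, μ ω = 1) (E : Set Ω) : probOf μ Eᶜ = 1 - probOf μ E := by
  rw [eq_sub_iff_add_eq, ← hsum, probOf, probOf, ← Finset.sum_add_distrib]
  exact Finset.sum_congr rfl fun ω _ => Set.indicator_compl_add_self_apply E μ ω

theorem probOf_singleton (ω : Ω) : probOf μ {ω} = μ ω := by
  classical
  rw [probOf, Finset.sum_eq_single ω]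
  · simp
  · intro b _ hb
    simp [hb]
  · simp

/-- Entropy depends only on the partition the variable induces on the support. -/
theorem shEntropy_congr (hμ : ∀ ω, 0 ≤ μ ω) {U : Ω → S} {V : Ω → T}
    (h : ∀ ω ω', 0 < μ ω → 0 < μ ω' → (U ω = U ω' ↔ V ω = V ω')) :
    shEntropy μ U = shEntropy μ V := by
  refine Finset.sum_congr rfl fun ω _ => ?_
  rcases (hμ ω).eq_or_lt with h0 | hω
  · simp [← h0]
  · rw [probOf_congr_of_pos hμ (E := {ω' | U ω' = U ω}) (F := {ω' | V ω' = V ω})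
      fun ω' hω' => h ω' ω hω' hω]

/-- A refinement with the same entropy induces the same partition of the support. -/
theorem eq_of_shEntropy_eq (hμ : ∀ ω, 0 ≤ μ ω) {U : Ω → S} {V : Ω → T}
    (href : ∀ ω ω', V ω = V ω' → U ω = U ω') (hH : shEntropy μ V = shEntropy μ U)
    {ω ω' : Ω} (hω : 0 < μ ω) (hω' : 0 < μ ω') (hU : U ω = U ω') : V ω = V ω' := by
  by_contra hV
  have key : ∀ x, 0 < μ x → 0 < probOf μ {y | V y = V x} := fun x hx =>
    probOf_pos hμ hx (by simp)
  refine hH.symm.not_lt (Finset.sum_lt_sum (fun x _ => ?_) ⟨ω, Finset.mem_univ ω, ?_⟩)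
  · rcases (hμ x).eq_or_lt with h0 | hx
    · simp [← h0]
    · refine mul_le_mul_of_nonneg_left (neg_le_neg ?_) hx.le
      exact Real.logb_le_logb_of_le one_lt_two (key x hx)
        (probOf_mono_of_pos hμ fun y _ hy => href y x hy)
  · refine mul_lt_mul_of_pos_left (neg_lt_neg ?_) hω
    refine Real.logb_lt_logb one_lt_two (key ω hω) ?_
    exact probOf_lt hμ (fun y hy => href y ω hy) hω' (fun h => hV h.symm) hU.symm

/-- The entropy of a variable that only records whether the event `E` occurs. -/
theorem shEntropy_eq_binEntropy (hμ : ∀ ω, 0 ≤ μ ω) (hsum : ∑ ω, μ ω = 1) {U : Ω → S}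
    {E : Set Ω}
    (h : ∀ ω ω', 0 < μ ω → 0 < μ ω' → (U ω = U ω' ↔ (ω ∈ E ↔ ω' ∈ E))) :
    shEntropy μ U = Real.binEntropy (probOf μ E) / Real.log 2 := by
  classical
  rw [shEntropy_congr hμ (V := fun ω => ω ∈ E) (by simpa using h)]
  have hterm : ∀ ω, μ ω * (-Real.logb 2 (probOf μ {ω' | (ω' ∈ E) = (ω ∈ E)})) =
      E.indicator μ ω * (-Real.logb 2 (probOf μ E)) +
        Eᶜ.indicator μ ω * (-Real.logb 2 (1 - probOf μ E)) := by
    intro ω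
    by_cases hω : ω ∈ E
    · simp [hω]
    · have : {ω' | (ω' ∈ E) = (ω ∈ E)} = Eᶜ := by ext; simp [hω]
      rw [this, probOf_compl hsum, Set.indicator_of_notMem hω,
        Set.indicator_of_mem (show ω ∈ Eᶜ from hω), zero_mul, zero_add]
  rw [shEntropy, Finset.sum_congr rfl fun ω _ => hterm ω, Finset.sum_add_distrib,
    ← Finset.sum_mul, ← Finset.sum_mul]
  change probOf μ E * _ + probOf μ Eᶜ * _ = _
  rw [probOf_compl hsum, Real.binEntropy, Real.logb, Real.logb, Real.log_inv, Real.log_inv]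
  ring

theorem probOf_le_one (hμ : ∀ ω, 0 ≤ μ ω) (hsum : ∑ ω, μ ω = 1) (E : Set Ω) :
    probOf μ E ≤ 1 := by
  rw [← hsum]
  exact Finset.sum_le_sum fun ω _ => Set.indicator_le_self' (fun x _ => hμ x) ω

theorem sum_probOf_eq_one (hsum : ∑ ω, μ ω = 1) (hμ : ∀ ω, 0 ≤ μ ω) {ι : Type*} [Fintype ι]
    {X : Ω → S} {t : ι → S} (ht : Function.Injective t)
    (hcover : ∀ ω, 0 < μ ω → ∃ i, t i = X ω) : ∑ i, probOf μ {ω | X ω = t i} = 1 := by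
  classical
  simp only [probOf]
  rw [Finset.sum_comm, ← hsum]
  refine Finset.sum_congr rfl fun ω _ => ?_
  rcases (hμ ω).eq_or_lt with h0 | hω
  · simp [← h0, Set.indicator_apply]
  · obtain ⟨i, hi⟩ := hcover ω hω
    rw [Finset.sum_eq_single i]
    · simp [hi]
    · intro j _ hj
      have : X ω ≠ t j := fun h => hj (ht (h.symm.trans hi.symm))
      simp [this]
    · simp

end Entropy

theorem eq_or_eq_one_sub_of_binEntropy_eq {x y : ℝ} (hx0 : 0 ≤ x) (hx1 : x ≤ 1) (hy0 : 0 ≤ y)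
    (hy1 : y ≤ 1) (h : Real.binEntropy x = Real.binEntropy y) : x = y ∨ x = 1 - y := by
  have inj := Real.binEntropy_strictMonoOn.injOn
  rcases le_total x (1 / 2) with hx | hx <;> rcases le_total y (1 / 2) with hy | hy
  · exact .inl (inj ⟨hx0, by linarith⟩ ⟨hy0, by linarith⟩ h)
  · exact .inr (inj ⟨hx0, by linarith⟩ ⟨by linarith, by linarith⟩
      (h.trans (Real.binEntropy_one_sub y).symm))
  · right
    have := inj ⟨by linarith, by linarith⟩ ⟨hy0, by linarith⟩
      ((Real.binEntropy_one_sub x).trans h)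
    linarith
  · left
    have := @inj (1 - x) ⟨by linarith, by linarith⟩
      (1 - y) ⟨by linarith, by linarith⟩ (by rw [Real.binEntropy_one_sub, Real.binEntropy_one_sub, h])
    linarith

section Splits

theorem card_image_lt_card_image_of_refines {X S T : Type*} [Fintype X] [DecidableEq S]
    [DecidableEq T] {U : X → S} {V : X → T} (href : ∀ x y, U x = U y → V x = V y) {x y : X}
    (hV : V x = V y) (hU : U x ≠ U y) :
    (Finset.univ.image V).card < (Finset.univ.image U).card := by
  classical
  have : Nonempty X := ⟨x⟩
  have hinv : ∀ z, V (Function.invFun U (U z)) = V z := fun z =>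
    href _ _ (Function.invFun_eq ⟨z, rfl⟩)
  have himg : Finset.univ.image V =
      (Finset.univ.image U).image fun s => V (Function.invFun U s) := by
    rw [Finset.image_image]
    exact Finset.image_congr fun z _ => (hinv z).symm
  rw [himg]
  refine lt_of_le_of_ne Finset.card_image_le fun hcard => hU ?_
  refine Finset.card_image_iff.1 hcard (by simp) (by simp) ?_
  simp only [hinv, hV]

variable {ι X : Type*} [Fintype X] {γ : ι → Type*}

open Classical in
/-- The block containing `x` of the common refinement of the partitions induced by `b i`,
`i ∈ Δ`. -/
noncomputable def jointBlock (b : ∀ i, X → γ i) (Δ : Finset ι) (x : X) : Finset X :=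
  Finset.univ.filter fun y => ∀ i ∈ Δ, b i x = b i y

open Classical in
/-- The number of blocks of the common refinement of the partitions induced by `b i`, `i ∈ Δ`. -/
noncomputable def numBlocks (b : ∀ i, X → γ i) (Δ : Finset ι) : ℕ :=
  (Finset.univ.image (jointBlock b Δ)).card

theorem jointBlock_eq_iff (b : ∀ i, X → γ i) (Δ : Finset ι) (x y : X) :
    jointBlock b Δ x = jointBlock b Δ y ↔ ∀ i ∈ Δ, b i x = b i y := by
  classical
  constructor
  · intro h
    have : y ∈ jointBlock b Δ x := h ▸ by simp [jointBlock]
    simpa [jointBlock] using this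
  · intro h
    ext z
    simp only [jointBlock, Finset.mem_filter, Finset.mem_univ, true_and]
    exact forall₂_congr fun i hi => by rw [h i hi]

theorem numBlocks_le_card (b : ∀ i, X → γ i) (Δ : Finset ι) :
    numBlocks b Δ ≤ Fintype.card X := by
  classical
  exact Finset.card_image_le

variable [Fintype ι] [DecidableEq ι]

/-- Each member of the family `b` strictly refines any subfamily, as long as the enlarged
subfamily is still proper. -/
def StrictlyRefining (b : ∀ i, X → γ i) : Prop :=
  ∀ (Δ : Finset ι) (a : ι), a ∉ Δ → insert a Δ ≠ Finset.univ →
    ∃ x y, (∀ i ∈ Δ, b i x = b i y) ∧ b a x ≠ b a y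

theorem StrictlyRefining.numBlocks_add_le {b : ∀ i, X → γ i} (hb : StrictlyRefining b)
    {Δ : Finset ι} (Γ : Finset ι) (hdisj : Disjoint Δ Γ) (hne : Δ ∪ Γ ≠ Finset.univ) :
    numBlocks b Δ + Γ.card ≤ numBlocks b (Δ ∪ Γ) := by
  classical
  induction Γ using Finset.induction_on with
  | empty => simp
  | insert a Γ ha ih =>
    rw [Finset.disjoint_insert_right] at hdisj
    rw [Finset.union_insert] at hne ⊢
    have hne' : Δ ∪ Γ ≠ Finset.univ := fun h => hne (by simp [h])
    have hlt : numBlocks b (Δ ∪ Γ) < numBlocks b (insert a (Δ ∪ Γ)) := by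
      obtain ⟨x, y, hxy, hne''⟩ := hb (Δ ∪ Γ) a (by simp [hdisj.1, ha]) hne
      refine card_image_lt_card_image_of_refines (x := x) (y := y) (fun z w h => ?_) ?_ ?_
      · rw [jointBlock_eq_iff] at h ⊢
        exact fun i hi => h i (Finset.mem_insert_of_mem hi)
      · rwa [jointBlock_eq_iff]
      · rw [Ne, jointBlock_eq_iff]
        exact fun h => hne'' (h a (Finset.mem_insert_self _ _))
    rw [Finset.card_insert_of_notMem ha]
    have := ih hdisj.2 hne'
    omega

theorem StrictlyRefining.card_add_one_le [Nonempty X] {b : ∀ i, X → γ i}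
    (hb : StrictlyRefining b) {Δ : Finset ι} (hne : Δ ≠ Finset.univ) :
    Δ.card + 1 ≤ numBlocks b Δ := by
  classical
  have h := hb.numBlocks_add_le (Δ := ∅) Δ (by simp) (by simpa using hne)
  have h1 : 0 < numBlocks b (∅ : Finset ι) :=
    Finset.card_pos.2 (Finset.univ_nonempty.image _)
  rw [Finset.empty_union] at h
  omega

theorem StrictlyRefining.le_card_add_one [Nonempty X] {b : ∀ i, X → γ i}
    (hb : StrictlyRefining b) (hcard : Fintype.card X ≤ Fintype.card ι) (Δ : Finset ι) :
    numBlocks b Δ ≤ Δ.card + 1 := by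
  classical
  by_cases hΔ : Δ = Finset.univ
  · have := numBlocks_le_card b Δ
    rw [hΔ, Finset.card_univ] at *
    omega
  · obtain ⟨c, hc⟩ : ∃ c, c ∉ Δ := by
      by_contra! h
      exact hΔ (Finset.eq_univ_of_forall h)
    have hsub : Δ ⊆ Finset.univ.erase c := fun i hi => by
      simp only [Finset.mem_erase, Finset.mem_univ, and_true]
      rintro rfl
      exact hc hi
    have h := hb.numBlocks_add_le (Δ := Δ) (Finset.univ.erase c \ Δ)
      Finset.disjoint_sdiff (by
        rw [Finset.union_sdiff_of_subset hsub]
        exact fun h => absurd (h ▸ Finset.mem_univ c) (Finset.notMem_erase c _))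
    have h1 := Finset.card_sdiff_add_card_eq_card hsub
    rw [Finset.card_erase_of_mem (Finset.mem_univ c), Finset.card_univ] at h1
    have h2 := numBlocks_le_card b (Δ ∪ (Finset.univ.erase c \ Δ))
    have : 0 < Fintype.card ι := Fintype.card_pos_iff.2 ⟨c⟩
    omega

theorem StrictlyRefining.card_eq [Nonempty X] [Nonempty ι] {b : ∀ i, X → γ i}
    (hb : StrictlyRefining b) (hcard : Fintype.card X ≤ Fintype.card ι) :
    Fintype.card X = Fintype.card ι := by
  classical
  obtain ⟨c⟩ := ‹Nonempty ι›
  have h := hb.card_add_one_le (Δ := Finset.univ.erase c)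
    (fun h => absurd (h ▸ Finset.mem_univ c) (Finset.notMem_erase c _))
  rw [Finset.card_erase_of_mem (Finset.mem_univ c), Finset.card_univ] at h
  have := numBlocks_le_card b (Finset.univ.erase c)
  omega

theorem StrictlyRefining.separates [Nonempty X] [Nonempty ι] {b : ∀ i, X → γ i}
    (hb : StrictlyRefining b) (hcard : Fintype.card X ≤ Fintype.card ι) {x y : X}
    (hxy : ∀ i, b i x = b i y) : x = y := by
  classical
  obtain ⟨c⟩ := ‹Nonempty ι›
  have h := hb.card_add_one_le (Δ := Finset.univ.erase c)
    (fun h => absurd (h ▸ Finset.mem_univ c) (Finset.notMem_erase c _))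
  rw [Finset.card_erase_of_mem (Finset.mem_univ c), Finset.card_univ] at h
  have hinj : (Finset.univ.image (jointBlock b (Finset.univ.erase c))).card =
      (Finset.univ : Finset X).card := by
    refine le_antisymm Finset.card_image_le ?_
    rw [Finset.card_univ]
    change _ ≤ numBlocks b _
    omega
  refine Finset.card_image_iff.1 hinj (by simp) (by simp) ?_
  rw [jointBlock_eq_iff]
  exact fun i _ => hxy i

/-- If every `b j` with `j ∈ Δ` is constant off `S`, then `S` has at least `#Δ` elements. -/
theorem StrictlyRefining.card_le_card_of_const [Nonempty X] {b : ∀ i, X → γ i}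
    (hb : StrictlyRefining b) {Δ : Finset ι} (hne : Δ ≠ Finset.univ) (S : Finset X)
    (hconst : ∀ j ∈ Δ, ∀ x ∉ S, ∀ y ∉ S, b j x = b j y) : Δ.card ≤ S.card := by
  classical
  have h := hb.card_add_one_le hne
  suffices numBlocks b Δ ≤ S.card + 1 by omega
  by_cases hS : ∃ y, y ∉ S
  · obtain ⟨y, hy⟩ := hS
    have hsub : Finset.univ.image (jointBlock b Δ) ⊆
        insert (jointBlock b Δ y) (S.image (jointBlock b Δ)) := by
      intro s hs
      obtain ⟨x, -, rfl⟩ := Finset.mem_image.1 hs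
      by_cases hx : x ∈ S
      · exact Finset.mem_insert_of_mem (Finset.mem_image_of_mem _ hx)
      · rw [(jointBlock_eq_iff b Δ x y).2 fun j hj => hconst j hj x hx y hy]
        exact Finset.mem_insert_self _ _
    calc numBlocks b Δ ≤ _ := Finset.card_le_card hsub
      _ ≤ (S.image (jointBlock b Δ)).card + 1 := Finset.card_insert_le _ _
      _ ≤ S.card + 1 := by gcongr; exact Finset.card_image_le
  · push Not at hS
    have := numBlocks_le_card b Δ
    rw [Finset.eq_univ_of_forall hS, Finset.card_univ]
    omega

/-- Every member of the family splits off a single point. -/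
theorem StrictlyRefining.exists_point [Nonempty X] {b : ∀ i, X → γ i}
    (hb : StrictlyRefining b) (hcard : Fintype.card X ≤ Fintype.card ι)
    (htwo : 2 ≤ Fintype.card ι) (i : ι) :
    ∃ t, ∀ x y, b i x = b i y ↔ (x = t ↔ y = t) := by
  classical
  have : Nonempty ι := ⟨i⟩
  obtain ⟨x₀, y₀, -, hxy⟩ := hb ∅ i (by simp) (fun h => by
    have := congrArg Finset.card h
    simp at this
    omega)
  have hbin : ∀ z, b i z = b i x₀ ∨ b i z = b i y₀ := by
    intro z
    by_contra! hz
    have h3 : ({jointBlock b {i} x₀, jointBlock b {i} y₀, jointBlock b {i} z} :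
        Finset (Finset X)).card = 3 := by
      rw [Finset.card_eq_three]
      refine ⟨_, _, _, ?_, ?_, ?_, rfl⟩ <;> rw [Ne, jointBlock_eq_iff] <;> simp
      exacts [hxy, hz.1.symm, hz.2.symm]
    have h2 := hb.le_card_add_one hcard {i}
    have hsub : ({jointBlock b {i} x₀, jointBlock b {i} y₀, jointBlock b {i} z} :
        Finset (Finset X)) ⊆ Finset.univ.image (jointBlock b {i}) := by
      intro s hs
      simp only [Finset.mem_insert, Finset.mem_singleton] at hs
      rcases hs with rfl | rfl | rfl <;> simp
    have := Finset.card_le_card hsub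
    simp only [Finset.card_singleton, numBlocks] at h2
    omega
  set S : Finset X := Finset.univ.filter fun z => b i z = b i x₀ with hS
  have memS : ∀ z, z ∈ S ↔ b i z = b i x₀ := fun z => by simp [hS]
  have memSc : ∀ z, z ∉ S ↔ b i z = b i y₀ := fun z => by
    rw [memS]
    rcases hbin z with h | h <;> simp [h, hxy, Ne.symm hxy]
  have heq : ∀ x y, b i x = b i y ↔ (x ∈ S ↔ y ∈ S) := by
    intro x y
    by_cases hx : x ∈ S <;> by_cases hy : y ∈ S <;> simp only [hx, hy, iff_true, iff_false,
      not_true]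
    · rw [(memS x).1 hx, (memS y).1 hy]
    · rw [(memS x).1 hx, (memSc y).1 hy]; exact hxy
    · rw [(memSc x).1 hx, (memS y).1 hy]; exact hxy.symm
    · rw [(memSc x).1 hx, (memSc y).1 hy]
  have hcompat : ∀ j, (∀ x ∉ S, ∀ y ∉ S, b j x = b j y) ∨ (∀ x ∈ S, ∀ y ∈ S, b j x = b j y) := by
    intro j
    by_contra! h
    obtain ⟨⟨x, hx, y, hy, hxy'⟩, z, hz, w, hw, hzw⟩ := h
    have hdiff : ∀ u v, (u ∈ S ∧ v ∉ S ∨ u ∉ S ∧ v ∈ S) ∨ b j u ≠ b j v →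
        jointBlock b {i, j} u ≠ jointBlock b {i, j} v := by
      intro u v huv h
      rw [jointBlock_eq_iff] at h
      have h1 := (heq u v).1 (h i (by simp))
      have h2 := h j (by simp)
      tauto
    have h4 : ({x, y, z, w} : Finset X).card = 4 ∧
        Set.InjOn (jointBlock b {i, j}) ({x, y, z, w} : Finset X) := by
      have e1 := hdiff x y (.inr hxy')
      have e2 := hdiff x z (.inl (by tauto))
      have e3 := hdiff x w (.inl (by tauto))
      have e4 := hdiff y z (.inl (by tauto))
      have e5 := hdiff y w (.inl (by tauto))
      have e6 := hdiff z w (.inr hzw)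
      constructor
      · rw [Finset.card_insert_of_notMem, Finset.card_insert_of_notMem,
          Finset.card_insert_of_notMem, Finset.card_singleton] <;>
          simp only [Finset.mem_insert, Finset.mem_singleton, not_or]
        · exact ne_of_apply_ne _ e6
        · exact ⟨ne_of_apply_ne _ e4, ne_of_apply_ne _ e5⟩
        · exact ⟨ne_of_apply_ne _ e1, ne_of_apply_ne _ e2, ne_of_apply_ne _ e3⟩
      · intro u hu v hv huv
        simp only [Finset.coe_insert, Finset.coe_singleton, Set.mem_insert_iff,
          Set.mem_singleton_iff] at hu hv
        rcases hu with rfl | rfl | rfl | rfl <;> rcases hv with rfl | rfl | rfl | rfl <;>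
          first | rfl | exact absurd huv ‹_› | exact absurd huv.symm ‹_›
    have h1 := hb.le_card_add_one hcard {i, j}
    have h2 := Finset.card_le_two (a := i) (b := j)
    have h3 := Finset.card_le_card (Finset.image_subset_image (f := jointBlock b {i, j})
      (Finset.subset_univ {x, y, z, w}))
    rw [Finset.card_image_of_injOn h4.2, h4.1] at h3
    change 4 ≤ numBlocks b {i, j} at h3
    omega
  have hfinish : (∀ j, ∀ x ∉ S, ∀ y ∉ S, b j x = b j y) ∨
      (∀ j, ∀ x ∈ S, ∀ y ∈ S, b j x = b j y) := by
    by_contra! hno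
    obtain ⟨⟨j₁, x₁, hx₁, y₁, hy₁, hj₁⟩, j₂, x₂, hx₂, y₂, hy₂, hj₂⟩ := hno
    set J₁ : Finset ι := Finset.univ.filter fun j => ∀ x ∉ S, ∀ y ∉ S, b j x = b j y with hJ₁
    set J₂ : Finset ι := Finset.univ.filter fun j => ∀ x ∈ S, ∀ y ∈ S, b j x = b j y with hJ₂
    have c₁ := hb.card_le_card_of_const (Δ := J₁) (fun h => by
      have : j₁ ∈ J₁ := h ▸ Finset.mem_univ _
      exact hj₁ ((Finset.mem_filter.1 this).2 x₁ hx₁ y₁ hy₁)) S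
      (fun j hj => (Finset.mem_filter.1 hj).2)
    have c₂ := hb.card_le_card_of_const (Δ := J₂) (fun h => by
      have : j₂ ∈ J₂ := h ▸ Finset.mem_univ _
      exact hj₂ ((Finset.mem_filter.1 this).2 x₂ hx₂ y₂ hy₂)) Sᶜ
      (fun j hj x hx y hy => (Finset.mem_filter.1 hj).2 x (by simpa using hx) y (by simpa using hy))
    have hunion : J₁ ∪ J₂ = Finset.univ := by
      ext j
      simpa [hJ₁, hJ₂] using hcompat j
    have hinter : i ∈ J₁ ∩ J₂ := by
      simp only [hJ₁, hJ₂, Finset.mem_inter, Finset.mem_filter, Finset.mem_univ, true_and]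
      exact ⟨fun x hx y hy => (heq x y).2 (by tauto), fun x hx y hy => (heq x y).2 (by tauto)⟩
    have hui := Finset.card_union_add_card_inter J₁ J₂
    rw [hunion, Finset.card_univ] at hui
    have hpos := Finset.card_pos.2 ⟨i, hinter⟩
    have hSS := Finset.card_add_card_compl S
    omega
  rcases hfinish with h | h
  · have hsing : ∀ z, z ∉ S ↔ z = y₀ := by
      have hy₀ : y₀ ∉ S := (memSc y₀).2 rfl
      refine fun z => ⟨fun hz => hb.separates hcard fun j => h j z hz y₀ hy₀, ?_⟩
      rintro rfl
      exact hy₀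
    exact ⟨y₀, fun x y => by rw [heq, ← hsing, ← hsing, not_iff_not]⟩
  · have hsing : ∀ z, z ∈ S ↔ z = x₀ := by
      have hx₀ : x₀ ∈ S := (memS x₀).2 rfl
      refine fun z => ⟨fun hz => hb.separates hcard fun j => h j z hz x₀ hx₀, ?_⟩
      rintro rfl
      exact hx₀
    exact ⟨x₀, fun x y => by rw [heq, hsing, hsing]⟩

end Splits

theorem StrictlyRefining.point_injective {ι X : Type*} {γ : ι → Type*} [Fintype ι]
    [DecidableEq ι] {b : ∀ i, X → γ i} (hb : StrictlyRefining b) (hthree : 3 ≤ Fintype.card ι)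
    {t : ι → X} (ht : ∀ i x y, b i x = b i y ↔ (x = t i ↔ y = t i)) : Function.Injective t := by
  intro i j hij
  by_contra hne
  obtain ⟨x, y, hj, hi⟩ := hb {j} i (by simpa using hne) (fun h => by
    have h1 := Finset.card_le_two (a := i) (b := j)
    rw [h, Finset.card_univ] at h1
    omega)
  rw [Ne, ht, hij, ← ht j] at hi
  exact hi (hj j (by simp))

theorem exists_pointPartition {n : ℕ} [NeZero n] (hn : 2 ≤ n) :
    ∃ s : Fin n → PartIdx n, ∀ i x y,
      bpVar (s i).1 x = bpVar (s i).1 y ↔ (x = i ↔ y = i) := by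
  refine ⟨fun i => if h : i = 0 then ⟨{0}ᶜ, ⟨⟨1, hn⟩, by simp⟩, by simp⟩
    else ⟨{i}, by simp, by simpa using Ne.symm h⟩, fun i x y => ?_⟩
  by_cases h : i = 0
  · simp [bpVar, h]
  · simp [bpVar, h]

/-- If `q` is obtained from `p` by replacing some masses by their complements, then `q = p`. -/
theorem eq_of_eq_or_eq_one_sub {ι : Type*} [Fintype ι] {p q : ι → ℝ}
    (hcard : 3 ≤ Fintype.card ι) (hp : ∀ i, 0 < p i) (hq : ∀ i, 0 < q i) (hpsum : ∑ i, p i = 1)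
    (hqsum : ∑ i, q i = 1) (h : ∀ i, q i = p i ∨ q i = 1 - p i) : q = p := by
  classical
  have hpair : ∀ i j, i ≠ j → p i + p j < 1 := by
    intro i j hij
    obtain ⟨k, hk⟩ : ∃ k, k ∉ ({i, j} : Finset ι) := by
      by_contra! hall
      have h1 := Finset.card_le_two (a := i) (b := j)
      rw [Finset.eq_univ_of_forall hall, Finset.card_univ] at h1
      omega
    rw [← hpsum, ← Finset.sum_pair hij]
    exact Finset.sum_lt_sum_of_subset (Finset.subset_univ _) (Finset.mem_univ k) hk (hp k)
      fun l _ _ => (hp l).le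
  have hpair' : ∀ i j, i ≠ j → q i + q j ≤ 1 := by
    intro i j hij
    rw [← hqsum, ← Finset.sum_pair hij]
    exact Finset.sum_le_sum_of_subset_of_nonneg (Finset.subset_univ _) fun l _ _ => (hq l).le
  funext i
  rcases h i with hi | hi
  · exact hi
  · have hrest : ∀ j ∈ Finset.univ.erase i, q j = p j := by
      intro j hj
      have hji := Finset.ne_of_mem_erase hj
      rcases h j with hj' | hj'
      · exact hj'
      · linarith [hpair j i hji, hpair' j i hji]
    rw [← Finset.add_sum_erase _ _ (Finset.mem_univ i)] at hpsum hqsum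
    rw [Finset.sum_congr rfl hrest] at hqsum
    linarith

theorem restrict_eq_restrict_iff {ι : Type*} {γ : ι → Type*} {Δ : Finset ι} (f g : ∀ i, γ i) :
    ((fun i : {x // x ∈ Δ} => f i.1) = fun i : {x // x ∈ Δ} => g i.1) ↔ ∀ i ∈ Δ, f i = g i :=
  funext_iff.trans Subtype.forall

theorem mem_rvSupport {Ω S : Type*} [Fintype Ω] {μ : Ω → ℝ} {X : Ω → S} {t : S} :
    t ∈ rvSupport μ X ↔ ∃ ω, 0 < μ ω ∧ X ω = t := by
  classical
  simp [rvSupport]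

/-- Theorem 3, distribution equivalence: suppose `X` has
support `{1, …, n}` with masses `p_1 ≥ … ≥ p_n > 0` (probability space
`Fin n`, `X = id`), with binary partition random variables `A_⟨α⟩`.  If `X*`
is another random variable whose support has size at most `n`, and
`(B_⟨α⟩, ⟨α⟩ ∈ Ω)` are random variables jointly distributed with `X*`
satisfying `H(B_⟨α⟩, ⟨α⟩ ∈ Δ) = H(A_⟨α⟩, ⟨α⟩ ∈ Δ)` for every `Δ ⊆ Ω` and
`H(B_⟨α⟩ | X*) = 0` for every `⟨α⟩ ∈ Ω`, then there is a map `σ` with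
`Pr(X = i) = Pr(X* = σ(i))` for all `i`; i.e. the distributions of `X` and
`X*` coincide up to renaming of outcomes. -/
theorem scalar_distribution_characterisation {n : ℕ} [NeZero n]
    (p : Fin n → ℝ) (hp : ∀ i, 0 < p i) (hsum : ∑ i, p i = 1)
    (hmono : ∀ i j : Fin n, i ≤ j → p j ≤ p i)
    {Ω' T : Type*} [Fintype Ω'] (ν : Ω' → ℝ)
    (hν0 : ∀ ω, 0 ≤ ν ω) (hν1 : ∑ ω, ν ω = 1)
    (Xstar : Ω' → T) (hcard : (rvSupport ν Xstar).card ≤ n)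
    {γ : PartIdx n → Type*} (B : (a : PartIdx n) → Ω' → γ a)
    (hBent : ∀ Δ : Finset (PartIdx n),
      shEntropy ν (fun ω (a : {x // x ∈ Δ}) => B a.1 ω) =
        shEntropy p (fun x (a : {x // x ∈ Δ}) => bpVar a.1.1 x))
    (hBfun : ∀ a : PartIdx n, shCondEntropy ν (B a) Xstar = 0) :
    ∃ σ : Fin n → T, ∀ i : Fin n, p i = probOf ν {ω | Xstar ω = σ i} := by
  classical
  obtain ⟨ω₀, hω₀⟩ : ∃ ω, 0 < ν ω := by
    by_contra! h
    have := Finset.sum_nonpos fun ω (_ : ω ∈ Finset.univ) => h ω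
    linarith
  have hp0 : ∀ i, 0 ≤ p i := fun i => (hp i).le
  have hmem : ∀ ω, 0 < ν ω → Xstar ω ∈ rvSupport ν Xstar := fun ω hω =>
    mem_rvSupport.2 ⟨ω, hω, rfl⟩
  rcases (show n = 1 ∨ 2 ≤ n by have := NeZero.pos n; omega) with rfl | hn
  · refine ⟨fun _ => Xstar ω₀, fun i => ?_⟩
    have h1 : probOf ν Set.univ = 1 := by simpa [probOf] using hν1
    rw [probOf_congr_of_pos hν0 (F := Set.univ), h1, ← hsum]
    · simp [Subsingleton.elim i 0]
    · intro ω hω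
      simpa using Finset.card_le_one.1 hcard _ (hmem ω hω) _ (hmem ω₀ hω₀)
  obtain ⟨s, hs⟩ := exists_pointPartition hn
  have hBeq : ∀ (Δ : Finset (PartIdx n)) ω ω',
      ((fun a : {x // x ∈ Δ} => B a.1 ω) = fun a : {x // x ∈ Δ} => B a.1 ω') ↔
        ∀ a ∈ Δ, B a ω = B a ω' :=
    fun Δ ω ω' => restrict_eq_restrict_iff (fun a => B a ω) fun a => B a ω'
  have hAeq : ∀ (Δ : Finset (PartIdx n)) x y,
      ((fun a : {x // x ∈ Δ} => bpVar a.1.1 x) = fun a : {x // x ∈ Δ} => bpVar a.1.1 y) ↔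
        ∀ a ∈ Δ, bpVar a.1 x = bpVar a.1 y :=
    fun Δ x y => restrict_eq_restrict_iff (fun a : PartIdx n => bpVar a.1 x) fun a => bpVar a.1 y
  have hfun : ∀ a ω ω', 0 < ν ω → 0 < ν ω' → Xstar ω = Xstar ω' → B a ω = B a ω' := by
    intro a ω ω' hω hω' hX
    have := eq_of_shEntropy_eq hν0 (U := Xstar) (V := fun ω => (Xstar ω, B a ω))
      (fun x y h => congrArg Prod.fst h) (sub_eq_zero.1 (hBfun a)) hω hω' hX
    exact congrArg Prod.snd this
  choose rep hrep_pos hrep using fun t : {t // t ∈ rvSupport ν Xstar} => mem_rvSupport.1 t.2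
  let b : (i : Fin n) → {t // t ∈ rvSupport ν Xstar} → γ (s i) := fun i t => B (s i) (rep t)
  have hbB : ∀ i ω (hω : 0 < ν ω), b i ⟨Xstar ω, hmem ω hω⟩ = B (s i) ω := fun i ω hω =>
    hfun _ _ _ (hrep_pos _) hω (hrep _)
  have hcard' : Fintype.card {t // t ∈ rvSupport ν Xstar} ≤ Fintype.card (Fin n) := by
    simpa using hcard
  have : Nonempty {t // t ∈ rvSupport ν Xstar} := ⟨⟨_, hmem ω₀ hω₀⟩⟩
  have hstrict : StrictlyRefining b := by
    intro Δ a ha hne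
    by_contra! hno
    obtain ⟨c, hc⟩ : ∃ c, c ∉ insert a Δ := by
      by_contra! h
      exact hne (Finset.eq_univ_of_forall h)
    have hB : shEntropy ν (fun ω (d : {x // x ∈ (insert a Δ).image s}) => B d.1 ω) =
        shEntropy ν (fun ω (d : {x // x ∈ Δ.image s}) => B d.1 ω) := by
      refine shEntropy_congr hν0 fun ω ω' hω hω' => ?_
      rw [hBeq, hBeq]
      simp only [Finset.forall_mem_image, Finset.forall_mem_insert]
      refine ⟨fun h => h.2, fun h => ⟨?_, h⟩⟩
      rw [← hbB _ _ hω, ← hbB _ _ hω']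
      refine hno _ _ fun i hi => ?_
      rw [hbB _ _ hω, hbB _ _ hω']
      exact h _ hi
    rw [hBent, hBent] at hB
    have hA := eq_of_shEntropy_eq hp0 (fun x y h => ?_) hB (hp a) (hp c) ?_
    · rw [hAeq] at hA
      simp only [Finset.forall_mem_image, Finset.forall_mem_insert] at hA
      have := (hs a a c).1 hA.1
      simp only [true_iff] at this
      exact hc (by simp [this])
    · rw [hAeq] at h ⊢
      simp only [Finset.forall_mem_image, Finset.forall_mem_insert] at h ⊢
      exact h.2
    · rw [hAeq]
      simp only [Finset.forall_mem_image]
      intro i hi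
      rw [hs]
      have hia : a ≠ i := fun h => ha (h ▸ hi)
      have hic : c ≠ i := fun h => hc (Finset.mem_insert_of_mem (h ▸ hi))
      simp [hia, hic]
  choose t ht using fun i => hstrict.exists_point hcard' (by simpa using hn) i
  have hq : ∀ i, probOf ν {ω | Xstar ω = t i} = p i ∨
      probOf ν {ω | Xstar ω = t i} = 1 - p i := by
    intro i
    have h1 := hBent {s i}
    rw [shEntropy_eq_binEntropy hν0 hν1 (E := {ω | Xstar ω = t i}),
      shEntropy_eq_binEntropy hp0 hsum (E := {i}), probOf_singleton] at h1
    · have hlog : Real.log 2 ≠ 0 := (Real.log_pos one_lt_two).ne'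
      have hpi : p i ≤ 1 := by
        rw [← hsum]
        exact Finset.single_le_sum (fun j _ => hp0 j) (Finset.mem_univ i)
      refine eq_or_eq_one_sub_of_binEntropy_eq
        (probOf_pos hν0 (hrep_pos (t i)) (hrep (t i))).le (probOf_le_one hν0 hν1 _) (hp0 i) hpi ?_
      exact (div_left_inj' hlog).1 h1
    · intro x y _ _
      rw [hAeq]
      simpa using hs i x y
    · intro ω ω' hω hω'
      have := ht i ⟨_, hmem ω hω⟩ ⟨_, hmem ω' hω'⟩
      rw [hbB _ _ hω, hbB _ _ hω'] at this
      simp only [Subtype.ext_iff] at this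
      rw [hBeq, Set.mem_ofPred_eq, Set.mem_ofPred_eq, ← this]
      exact ⟨fun h => h _ (Finset.mem_singleton_self _), fun h a ha => by
        rw [Finset.mem_singleton.1 ha, h]⟩
  have : Nonempty (Fin n) := ⟨0⟩
  have hcardeq := hstrict.card_eq hcard'
  rcases (show n = 2 ∨ 3 ≤ n by omega) with rfl | hn3
  · obtain ⟨u, hu⟩ : ∃ u : {t // t ∈ rvSupport ν Xstar}, u ≠ t 0 := by
      have : Nontrivial {t // t ∈ rvSupport ν Xstar} := by
        rw [← Fintype.one_lt_card_iff_nontrivial, hcardeq]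
        simp
      exact exists_ne _
    have huniv : ∀ v : {t // t ∈ rvSupport ν Xstar}, v ≠ t 0 → v = u := by
      intro v hv
      by_contra hvu
      have h3 : ({v, t 0, u} : Finset {t // t ∈ rvSupport ν Xstar}).card = 3 :=
        Finset.card_eq_three.2 ⟨v, t 0, u, hv, hvu, hu.symm, rfl⟩
      have := Finset.card_le_univ ({v, t 0, u} : Finset {t // t ∈ rvSupport ν Xstar})
      rw [hcardeq, h3] at this
      simp at this
    have hqu : probOf ν {ω | Xstar ω = u} = 1 - probOf ν {ω | Xstar ω = t 0} := by
      rw [← probOf_compl hν1]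
      refine probOf_congr_of_pos hν0 fun ω hω => ⟨fun h h' => ?_, fun h => ?_⟩
      · exact hu (Subtype.ext (h.symm.trans h'))
      · exact congrArg Subtype.val (huniv ⟨_, hmem ω hω⟩ fun h' => h (congrArg Subtype.val h'))
    rw [Fin.sum_univ_two] at hsum
    rcases hq 0 with h0 | h0
    · refine ⟨![t 0, u], Fin.forall_fin_two.2 ⟨h0.symm, ?_⟩⟩
      change _ = probOf ν {ω | Xstar ω = u}
      linarith
    · refine ⟨![u, t 0], Fin.forall_fin_two.2 ⟨?_, ?_⟩⟩
      · change _ = probOf ν {ω | Xstar ω = u}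
        linarith
      · change _ = probOf ν {ω | Xstar ω = t 0}
        linarith
  · have hinj := hstrict.point_injective (by simpa using hn3) ht
    have hsurj : Function.Surjective t :=
      ((Fintype.bijective_iff_injective_and_card t).2 ⟨hinj, hcardeq.symm⟩).2
    have hqsum : ∑ i, probOf ν {ω | Xstar ω = t i} = 1 :=
      sum_probOf_eq_one hν1 hν0 (t := fun i => (t i : T)) (Subtype.val_injective.comp hinj)
        fun ω hω => (hsurj ⟨_, hmem ω hω⟩).imp fun i hi => by rw [hi]
    have hqp := eq_of_eq_or_eq_one_sub (by simpa using hn3) hp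
      (fun i => probOf_pos hν0 (hrep_pos (t i)) (hrep (t i))) hsum hqsum hq
    exact ⟨fun i => t i, fun i => (congrFun hqp i).symm⟩
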